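/- For every irreducible Markov chain on a finite state space: if T(1/100) = (999/10)·T(1/50), then T(99/100) ≥ (1/10)·T(1/50). -/

import Mathlib

/-- `P` is a row-stochastic transition matrix on the finite state space `Ω`. -/
def IsTransitionMatrix {Ω : Type*} [Fintype Ω] (P : Matrix Ω Ω ℝ) : Prop :=
  (∀ x y, 0 ≤ P x y) ∧ ∀ x, ∑ y, P x y = 1

/-- The chain is irreducible: any state can reach any other state. -/
def IsIrreducibleChain {Ω : Type*} [Fintype Ω] [DecidableEq Ω] (P : Matrix Ω Ω ℝ) : Prop :=
  ∀ x y, ∃ n : ℕ, 0 < (P ^ n) x y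

/-- `π` is a stationary distribution for `P`. -/
def IsStationaryDist {Ω : Type*} [Fintype Ω] (P : Matrix Ω Ω ℝ) (π : Ω → ℝ) : Prop :=
  (∀ x, 0 ≤ π x) ∧ (∑ x, π x = 1) ∧ ∀ y, ∑ x, π x * P x y = π y

/-- The expected hitting time `E_x[τ_A] = ∑_{t=0}^∞ ∑_{y ∉ A} Qᵗ(x,y)`, where `Q` is `P`
with rows and columns indexed by `A` replaced by zero. -/
noncomputable def hitTime {Ω : Type*} [Fintype Ω] [DecidableEq Ω]
    (P : Matrix Ω Ω ℝ) (A : Finset Ω) (x : Ω) : ℝ :=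
  ∑' t : ℕ, ∑ y ∈ Aᶜ, (((Matrix.of fun u v => if u ∈ A ∨ v ∈ A then (0:ℝ) else P u v)) ^ t) x y

/-- `T(α)`: the maximum expected hitting time of a set of stationary measure at least `α`. -/
noncomputable def Tfun {Ω : Type*} [Fintype Ω] [DecidableEq Ω]
    (P : Matrix Ω Ω ℝ) (π : Ω → ℝ) (α : ℝ) : ℝ :=
  sSup {r | ∃ (x : Ω) (A : Finset Ω), α ≤ ∑ a ∈ A, π a ∧ r = hitTime P A x}

/-- `d⁺(A,B) = max_{x ∈ A} E_x[τ_B]`. -/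
noncomputable def dplus {Ω : Type*} [Fintype Ω] [DecidableEq Ω]
    (P : Matrix Ω Ω ℝ) (A B : Finset Ω) : ℝ :=
  sSup {r | ∃ x ∈ A, r = hitTime P B x}

/-- `d⁻(A,B) = min_{x ∈ A} E_x[τ_B]`. -/
noncomputable def dminus {Ω : Type*} [Fintype Ω] [DecidableEq Ω]
    (P : Matrix Ω Ω ℝ) (A B : Finset Ω) : ℝ :=
  sInf {r | ∃ x ∈ A, r = hitTime P B x}

open Finset in
lemma max_principle {Ω : Type*} [Fintype Ω] [DecidableEq Ω] {P : Matrix Ω Ω ℝ}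
    (hP : IsTransitionMatrix P) (hirr : IsIrreducibleChain P)
    (S : Finset Ω) (hS : S.Nonempty) (f : Ω → ℝ) (h0 : ∀ x ∈ S, f x ≤ 0)
    (hf : ∀ x, x ∉ S → f x ≤ ∑ y, P x y * f y) (x : Ω) : f x ≤ 0 := by
  obtain ⟨m, -, hm⟩ := Finset.exists_max_image Finset.univ f ⟨x, Finset.mem_univ x⟩
  have hm' : ∀ y, f y ≤ f m := fun y => hm y (Finset.mem_univ y)
  by_contra hx
  have hpos : 0 < f m := by linarith [hm' x]
  have key : ∀ n : ℕ, ∀ y, 0 < (P ^ n) m y → f y = f m := by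
    intro n
    induction n with
    | zero =>
      intro y hy
      by_cases e : m = y
      · rw [e]
      · simp [Matrix.one_apply, e] at hy
    | succ n ih =>
      intro y hy
      have hnn : ∀ z, 0 ≤ (P ^ n) m z := by
        intro z
        have : ∀ k : ℕ, ∀ a b, 0 ≤ (P ^ k) a b := by
          intro k
          induction k with
          | zero => intro a b; simp only [pow_zero, Matrix.one_apply]; split_ifs <;> norm_num
          | succ k ih =>
            intro a b
            rw [pow_succ, Matrix.mul_apply]
            exact Finset.sum_nonneg fun i _ => mul_nonneg (ih _ _) (hP.1 _ _)
        exact this n m z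
      rw [pow_succ, Matrix.mul_apply] at hy
      obtain ⟨z, -, hz⟩ := Finset.exists_lt_of_sum_lt
        (show ∑ z : Ω, (0:ℝ) < ∑ z, (P ^ n) m z * P z y by simpa using hy)
      have hz1 : 0 < (P ^ n) m z := by
        rcases (hnn z).lt_or_eq with h | h
        · exact h
        · rw [← h] at hz; simp at hz
      have hz2 : 0 < P z y := by
        rcases (hP.1 z y).lt_or_eq with h | h
        · exact h
        · rw [← h] at hz; simp at hz
      have hfz := ih z hz1
      have hzS : z ∉ S := fun hzS => by linarith [h0 z hzS]
      have h1 := hf z hzS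
      have h2 : ∑ w, P z w * (f m - f w) = f m - ∑ w, P z w * f w := by
        simp only [mul_sub, Finset.sum_sub_distrib, ← Finset.sum_mul, hP.2 z, one_mul]
      have h3 : P z y * (f m - f y) ≤ ∑ w, P z w * (f m - f w) :=
        Finset.single_le_sum (f := fun w => P z w * (f m - f w))
          (fun w _ => mul_nonneg (hP.1 _ _) (by linarith [hm' w])) (Finset.mem_univ y)
      have h4 : P z y * (f m - f y) ≤ 0 := by linarith
      have h5 : f m - f y ≤ 0 := by
        by_contra hc
        have := mul_pos hz2 (not_le.mp hc)
        linarith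
      linarith [hm' y]
  obtain ⟨s, hs⟩ := hS
  obtain ⟨n, hn⟩ := hirr m s
  linarith [key n s hn, h0 s hs]

/-- killed matrix -/
def killed {Ω : Type*} [DecidableEq Ω] (P : Matrix Ω Ω ℝ) (A : Finset Ω) : Matrix Ω Ω ℝ :=
  Matrix.of fun u v => if u ∈ A ∨ v ∈ A then (0:ℝ) else P u v

lemma killed_nonneg {Ω : Type*} [Fintype Ω] [DecidableEq Ω] {P : Matrix Ω Ω ℝ}
    (hP : IsTransitionMatrix P) (A : Finset Ω) (t : ℕ) (x y : Ω) :
    0 ≤ ((killed P A) ^ t) x y := by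
  induction t generalizing x y with
  | zero => simp only [pow_zero, Matrix.one_apply]; split_ifs <;> norm_num
  | succ k ih =>
    rw [pow_succ, Matrix.mul_apply]
    refine Finset.sum_nonneg fun i _ => mul_nonneg (ih _ _) ?_
    simp only [killed, Matrix.of_apply]
    split_ifs
    · exact le_rfl
    · exact hP.1 _ _

/-- the t-th term of the series -/
noncomputable def surv {Ω : Type*} [Fintype Ω] [DecidableEq Ω]
    (P : Matrix Ω Ω ℝ) (A : Finset Ω) (t : ℕ) (x : Ω) : ℝ :=
  ∑ y ∈ Aᶜ, ((killed P A) ^ t) x y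

lemma hitTime_eq {Ω : Type*} [Fintype Ω] [DecidableEq Ω]
    (P : Matrix Ω Ω ℝ) (A : Finset Ω) (x : Ω) : hitTime P A x = ∑' t, surv P A t x := rfl

lemma surv_nonneg {Ω : Type*} [Fintype Ω] [DecidableEq Ω] {P : Matrix Ω Ω ℝ}
    (hP : IsTransitionMatrix P) (A : Finset Ω) (t : ℕ) (x : Ω) : 0 ≤ surv P A t x :=
  Finset.sum_nonneg fun _ _ => killed_nonneg hP A t _ _

lemma surv_zero {Ω : Type*} [Fintype Ω] [DecidableEq Ω] (P : Matrix Ω Ω ℝ)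
    (A : Finset Ω) (x : Ω) : surv P A 0 x = if x ∈ A then 0 else 1 := by
  simp only [surv, pow_zero, Matrix.one_apply, Finset.sum_ite_eq, Finset.mem_compl]
  split_ifs <;> simp_all

lemma surv_succ {Ω : Type*} [Fintype Ω] [DecidableEq Ω] (P : Matrix Ω Ω ℝ)
    (A : Finset Ω) (t : ℕ) (x : Ω) :
    surv P A (t+1) x = ∑ z, killed P A x z * surv P A t z := by
  simp only [surv, pow_succ', Matrix.mul_apply, Finset.mul_sum]
  rw [Finset.sum_comm]

lemma surv_mem {Ω : Type*} [Fintype Ω] [DecidableEq Ω] (P : Matrix Ω Ω ℝ)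
    (A : Finset Ω) (t : ℕ) (x : Ω) (hx : x ∈ A) : surv P A t x = 0 := by
  cases t with
  | zero => simp [surv_zero, hx]
  | succ t => rw [surv_succ]; simp [killed, hx]

lemma killed_sum {Ω : Type*} [Fintype Ω] [DecidableEq Ω] (P : Matrix Ω Ω ℝ)
    (A : Finset Ω) (x : Ω) (hx : x ∉ A) (v : Ω → ℝ) (hv : ∀ y ∈ A, v y = 0) :
    ∑ z, killed P A x z * v z = ∑ z, P x z * v z := by
  refine Finset.sum_congr rfl fun z _ => ?_
  by_cases hz : z ∈ A
  · simp [hv z hz]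
  · simp [killed, hx, hz]

lemma exists_sol {Ω : Type*} [Fintype Ω] [DecidableEq Ω] {P : Matrix Ω Ω ℝ}
    (hP : IsTransitionMatrix P) (hirr : IsIrreducibleChain P)
    (A : Finset Ω) (hA : A.Nonempty) :
    ∃ v : Ω → ℝ, (∀ x, 0 ≤ v x) ∧
      ∀ x, v x = (if x ∈ A then 0 else 1) + ∑ z, killed P A x z * v z := by
  let L : (Ω → ℝ) →ₗ[ℝ] (Ω → ℝ) := Matrix.toLin' (1 - killed P A)
  have hL : ∀ v x, L v x = v x - ∑ z, killed P A x z * v z := by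
    intro v x
    simp [L, Matrix.toLin'_apply, Matrix.sub_mulVec, Matrix.mulVec, dotProduct]
  have hL0 : ∀ v, ∀ x ∈ A, L v x = v x := by
    intro v x hx
    rw [hL]; simp [killed, hx]
  have neg : ∀ v, (∀ x, L v x ≤ 0) → (∀ x ∈ A, v x = 0) → ∀ x, v x ≤ 0 := by
    intro v h1 h2
    refine max_principle hP hirr A hA v (fun x hx => (h2 x hx).le) fun x hx => ?_
    have := h1 x
    rw [hL, killed_sum P A x hx v h2] at this
    linarith
  have inj : Function.Injective L := by
    rw [← LinearMap.ker_eq_bot, LinearMap.ker_eq_bot']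
    intro v hv
    have hz : ∀ x ∈ A, v x = 0 := fun x hx => by rw [← hL0 v x hx, hv]; rfl
    funext x
    have h1 := neg v (fun x => by rw [hv]; exact le_rfl) hz x
    have h2 := neg (-v) (fun x => by rw [map_neg, hv]; simp) (fun x hx => by simp [hz x hx]) x
    simp only [Pi.neg_apply] at h2
    exact le_antisymm h1 (by show (0:ℝ) ≤ v x; linarith)
  obtain ⟨v, hv⟩ := (LinearMap.injective_iff_surjective.mp inj)
    (fun x => if x ∈ A then (0:ℝ) else 1)
  refine ⟨v, fun x => ?_, fun x => ?_⟩
  · have hz : ∀ x ∈ A, v x = 0 := fun x hx => by rw [← hL0 v x hx, hv]; simp [hx]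
    have h2 := neg (-v) (fun x => by
      rw [map_neg, hv]; simp only [Pi.neg_apply]; split_ifs <;> norm_num)
      (fun x hx => by simp [hz x hx]) x
    simp only [Pi.neg_apply] at h2
    linarith
  · have := congrFun hv x
    rw [hL] at this
    linarith

lemma surv_summable {Ω : Type*} [Fintype Ω] [DecidableEq Ω] {P : Matrix Ω Ω ℝ}
    (hP : IsTransitionMatrix P) (hirr : IsIrreducibleChain P)
    (A : Finset Ω) (hA : A.Nonempty) (x : Ω) : Summable fun t => surv P A t x := by
  obtain ⟨v, hv0, hv⟩ := exists_sol hP hirr A hA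
  refine summable_of_sum_range_le (c := v x) (fun t => surv_nonneg hP A t x) fun n => ?_
  induction n generalizing x with
  | zero => simpa using hv0 x
  | succ n ih =>
    rw [Finset.sum_range_succ', surv_zero, hv x, add_comm]
    simp only [surv_succ]
    rw [Finset.sum_comm]
    simp only [← Finset.mul_sum]
    gcongr with z _
    · simpa using killed_nonneg hP A 1 x z
    · exact ih z

lemma hit_nonneg {Ω : Type*} [Fintype Ω] [DecidableEq Ω] {P : Matrix Ω Ω ℝ}
    (hP : IsTransitionMatrix P) (A : Finset Ω) (x : Ω) : 0 ≤ hitTime P A x := by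
  rw [hitTime_eq]; exact tsum_nonneg fun t => surv_nonneg hP A t x

lemma hit_mem {Ω : Type*} [Fintype Ω] [DecidableEq Ω] (P : Matrix Ω Ω ℝ)
    (A : Finset Ω) (x : Ω) (hx : x ∈ A) : hitTime P A x = 0 := by
  rw [hitTime_eq]; simp [surv_mem P A _ x hx]

lemma hit_rec {Ω : Type*} [Fintype Ω] [DecidableEq Ω] {P : Matrix Ω Ω ℝ}
    (hP : IsTransitionMatrix P) (hirr : IsIrreducibleChain P)
    (A : Finset Ω) (hA : A.Nonempty) (x : Ω) (hx : x ∉ A) :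
    hitTime P A x = 1 + ∑ y, P x y * hitTime P A y := by
  rw [← killed_sum P A x hx _ (fun y hy => hit_mem P A y hy)]
  have hs := surv_summable hP hirr A hA
  rw [hitTime_eq, (hs x).tsum_eq_zero_add, surv_zero, if_neg hx]
  simp only [surv_succ, hitTime_eq]
  rw [Summable.tsum_finsetSum (fun z _ => (hs z).mul_left _)]
  simp only [tsum_mul_left]

lemma hit_transfer {Ω : Type*} [Fintype Ω] [DecidableEq Ω] {P : Matrix Ω Ω ℝ}
    (hP : IsTransitionMatrix P) (hirr : IsIrreducibleChain P)
    (A S : Finset Ω) (hA : A.Nonempty) (hS : S.Nonempty) (m : ℝ) (hm0 : 0 ≤ m)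
    (hm : ∀ y ∈ S, hitTime P A y ≤ m) (x : Ω) :
    hitTime P A x ≤ hitTime P S x + m := by
  have := max_principle hP hirr (S ∪ A) (hS.mono Finset.subset_union_left)
    (fun y => hitTime P A y - hitTime P S y - m) ?_ ?_ x
  · linarith
  · intro y hy
    have h1 := hit_nonneg hP S y
    rcases Finset.mem_union.mp hy with h | h
    · linarith [hm y h]
    · have := hit_mem P A y h
      linarith
  · intro y hy
    rw [Finset.mem_union, not_or] at hy
    simp only [mul_sub, Finset.sum_sub_distrib, ← Finset.sum_mul, hP.2 y]
    linarith [hit_rec hP hirr A hA y hy.2, hit_rec hP hirr S hS y hy.1]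

/-- `π(A) d⁻(B,A) ≤ (1-π(A)) d⁺(A,B)`. -/
lemma cycle_bound {Ω : Type*} [Fintype Ω] [DecidableEq Ω] {P : Matrix Ω Ω ℝ} {π : Ω → ℝ}
    (hP : IsTransitionMatrix P) (hirr : IsIrreducibleChain P) (hπ : IsStationaryDist P π)
    (A B : Finset Ω) (hA : A.Nonempty) (hB : B.Nonempty) (l u : ℝ) (hl : 0 < l) (hu : 0 ≤ u)
    (hAB : ∀ a ∈ A, hitTime P B a ≤ u) (hBA : ∀ b ∈ B, l ≤ hitTime P A b) :
    (∑ a ∈ A, π a) * l ≤ (1 - ∑ a ∈ A, π a) * u := by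
  set f1 : Ω → ℝ := fun x => l * (hitTime P B x - u) with hf1
  set f2 : Ω → ℝ := fun x => - u * hitTime P A x with hf2
  set f : Ω → ℝ := fun x => min (f1 x) (f2 x) with hf
  have hdisj : ∀ x ∈ A, x ∉ B := by
    intro x hx hxB
    have := hBA x hxB
    rw [hit_mem P A x hx] at this
    linarith
  have P1 : ∀ x, ∑ y, P x y * f x = f x := fun x => by rw [← Finset.sum_mul, hP.2, one_mul]
  have le1 : ∀ x, ∑ y, P x y * f y ≤ ∑ y, P x y * f1 y := fun x =>
    Finset.sum_le_sum fun y _ => mul_le_mul_of_nonneg_left (min_le_left _ _) (hP.1 _ _)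
  have le2 : ∀ x, ∑ y, P x y * f y ≤ ∑ y, P x y * f2 y := fun x =>
    Finset.sum_le_sum fun y _ => mul_le_mul_of_nonneg_left (min_le_right _ _) (hP.1 _ _)
  have e1 : ∀ x, x ∉ B → ∑ y, P x y * f1 y = f1 x - l := by
    intro x hx
    have : ∑ y, P x y * f1 y = l * (∑ y, P x y * hitTime P B y) - l * u := by
      have : ∀ y, P x y * f1 y = l * (P x y * hitTime P B y) - P x y * (l * u) := by
        intro y; simp only [hf1]; ring
      simp only [this, Finset.sum_sub_distrib, ← Finset.mul_sum, ← Finset.sum_mul, hP.2 x, one_mul]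
    rw [this]; simp only [hf1]; rw [hit_rec hP hirr B hB x hx]; ring
  have e2 : ∀ x, x ∉ A → ∑ y, P x y * f2 y = f2 x + u := by
    intro x hx
    have : ∑ y, P x y * f2 y = -u * (∑ y, P x y * hitTime P A y) := by
      rw [Finset.mul_sum]
      refine Finset.sum_congr rfl fun y _ => ?_
      simp only [hf2]; ring
    rw [this]; simp only [hf2]; rw [hit_rec hP hirr A hA x hx]; ring
  have step : ∀ x, ∑ y, P x y * f y ≤ f x + (if x ∈ A then -l else u) := by
    intro x
    by_cases hx : x ∈ A
    · have h1 : f x = f1 x := by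
        apply min_eq_left
        simp only [hf1, hf2, hit_mem P A x hx, mul_zero]
        exact mul_nonpos_of_nonneg_of_nonpos hl.le (by linarith [hAB x hx])
      rw [if_pos hx, h1]
      linarith [le1 x, e1 x (hdisj x hx)]
    · rw [if_neg hx]
      by_cases hxB : x ∈ B
      · have h1 : f x = f2 x := by
          apply min_eq_right
          simp only [hf1, hf2, hit_mem P B x hxB]
          nlinarith [hBA x hxB]
        rw [h1]; linarith [le2 x, e2 x hx]
      · have : f x = f1 x ∨ f x = f2 x := min_choice _ _
        rcases this with h1 | h1
        · rw [h1]; linarith [le1 x, e1 x hxB]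
        · rw [h1]; linarith [le2 x, e2 x hx]
  have tot : ∑ x, π x * ∑ y, P x y * f y = ∑ x, π x * f x := by
    simp only [Finset.mul_sum]
    rw [Finset.sum_comm]
    refine Finset.sum_congr rfl fun y _ => ?_
    rw [← hπ.2.2 y, Finset.sum_mul]
    exact Finset.sum_congr rfl fun x _ => by ring
  have tot2 : ∑ x, π x * ∑ y, P x y * f y ≤ ∑ x, π x * (f x + (if x ∈ A then -l else u)) :=
    Finset.sum_le_sum fun x _ => mul_le_mul_of_nonneg_left (step x) (hπ.1 x)
  have e3 : ∑ x, π x * (f x + (if x ∈ A then -l else u))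
      = ∑ x, π x * f x + (u - (∑ a ∈ A, π a) * (l + u)) := by
    have : ∀ x, π x * (f x + (if x ∈ A then -l else u))
      = π x * f x + (π x * u - (if x ∈ A then π x else 0) * (l + u)) := by
      intro x; split_ifs <;> ring
    simp only [this, Finset.sum_add_distrib, Finset.sum_sub_distrib, ← Finset.sum_mul, hπ.2.1]
    simp [Finset.sum_ite_mem]
  rw [tot, e3] at tot2
  nlinarith

lemma Tfun_finite {Ω : Type*} [Fintype Ω] [DecidableEq Ω] (P : Matrix Ω Ω ℝ) (π : Ω → ℝ) (α : ℝ) :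
    {r | ∃ (x : Ω) (A : Finset Ω), α ≤ ∑ a ∈ A, π a ∧ r = hitTime P A x}.Finite := by
  refine (Set.finite_range (fun p : Ω × Finset Ω => hitTime P p.2 p.1)).subset ?_
  rintro r ⟨x, A, -, rfl⟩
  exact ⟨(x, A), rfl⟩

lemma le_Tfun {Ω : Type*} [Fintype Ω] [DecidableEq Ω] (P : Matrix Ω Ω ℝ) (π : Ω → ℝ) (α : ℝ)
    (A : Finset Ω) (hA : α ≤ ∑ a ∈ A, π a) (x : Ω) : hitTime P A x ≤ Tfun P π α :=
  le_csSup (Tfun_finite P π α).bddAbove ⟨x, A, hA, rfl⟩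

/-- For every irreducible Markov chain on a finite state space, if
`T(0.01) = 99.9·T(0.02)` then `T(0.99) ≥ 0.1·T(0.02)`. -/
theorem T_additional_constraint {Ω : Type*} [Fintype Ω] [DecidableEq Ω] [Nonempty Ω]
    (P : Matrix Ω Ω ℝ) (π : Ω → ℝ)
    (hP : IsTransitionMatrix P) (hirr : IsIrreducibleChain P) (hπ : IsStationaryDist P π)
    (h : Tfun P π (1/100) = (999/10) * Tfun P π (1/50)) :
    (1/10) * Tfun P π (1/50) ≤ Tfun P π (99/100) := by
  have nn : ∀ α, 0 ≤ Tfun P π α := by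
    intro α
    apply Real.sSup_nonneg
    rintro r ⟨x, A, -, rfl⟩
    exact hit_nonneg hP A x
  have compl : ∀ S : Finset Ω, ∑ a ∈ Sᶜ, π a = 1 - ∑ a ∈ S, π a := by
    intro S
    have := Finset.sum_add_sum_compl S π
    rw [hπ.2.1] at this
    linarith
  have ne : ∀ S : Finset Ω, 0 < ∑ a ∈ S, π a → S.Nonempty := by
    intro S hS
    rw [Finset.nonempty_iff_ne_empty]
    rintro rfl
    simp at hS
  have b50 := fun S hS x => le_Tfun P π (1/50) S hS x
  have b99 := fun S hS x => le_Tfun P π (99/100) S hS x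
  have b1 := fun S hS x => le_Tfun P π (1/100) S hS x
  obtain ⟨x, A, hA, hx⟩ : ∃ (x : Ω) (A : Finset Ω), 1/100 ≤ ∑ a ∈ A, π a ∧
      Tfun P π (1/100) = hitTime P A x := by
    refine Set.Nonempty.csSup_mem ?_ (Tfun_finite P π (1/100))
    obtain ⟨x0⟩ := ‹Nonempty Ω›
    exact ⟨_, x0, Finset.univ, by rw [hπ.2.1]; norm_num, rfl⟩
  rw [h] at hx
  rw [h] at b1
  rcases (nn (1/50)).eq_or_lt with hT0 | hT
  · rw [← hT0]; simpa using nn (99/100)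
  set T := Tfun P π (1/50) with hTdef
  have hAne := ne A (by linarith)
  have hAT := b1 A hA
  -- Step 1
  set C : Finset Ω := Finset.univ.filter fun y => 98 * T ≤ hitTime P A y with hC
  have hCm : 1/50 ≤ ∑ a ∈ C, π a := by
    by_contra hc
    have h1 : 1/50 ≤ ∑ a ∈ Cᶜ, π a := by rw [compl]; linarith
    have := hit_transfer hP hirr A Cᶜ hAne (ne _ (by linarith)) (98*T) (by positivity)
      (fun y hy => by simp [hC] at hy; linarith) x
    linarith [b50 _ h1 x]
  -- Step 2
  set Z : Finset Ω := Finset.univ.filter fun y => hitTime P A y < (9905/100) * T with hZ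
  have hZm : 98/100 < ∑ a ∈ Z, π a := by
    by_contra hc
    have h1 : 1/50 ≤ ∑ a ∈ Zᶜ, π a := by rw [compl]; linarith
    have := cycle_bound hP hirr hπ A Zᶜ hAne (ne _ (by linarith)) ((9905/100)*T) T
      (by positivity) hT.le (fun a _ => b50 _ h1 a) (fun b hb => by simpa [hZ] using hb)
    nlinarith
  have hZne := ne Z (by linarith)
  set W : Finset Ω := Finset.univ.filter fun y => (998/10) * T < hitTime P A y with hW
  have hxW : x ∈ W := by simp only [hW, Finset.mem_filter, Finset.mem_univ, true_and]; linarith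
  have hWne : W.Nonempty := ⟨x, hxW⟩
  have hdis : Disjoint A W := by
    rw [Finset.disjoint_left]
    intro a ha haW
    simp only [hW, Finset.mem_filter, Finset.mem_univ, true_and, hit_mem P A a ha] at haW
    linarith
  -- Step 3
  have hAW : ∑ a ∈ A ∪ W, π a < 1/50 := by
    by_contra hc
    have hs := b50 (A ∪ W) (not_lt.mp hc)
    obtain ⟨m, -, hm⟩ := Finset.exists_max_image Finset.univ (hitTime P W) ⟨x, Finset.mem_univ x⟩
    set M := hitTime P W m with hM
    have hm' : ∀ y, hitTime P W y ≤ M := fun y => hm y (Finset.mem_univ y)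
    have hM0 : 0 ≤ M := hit_nonneg hP W m
    have hAWne : (A ∪ W).Nonempty := hAne.mono Finset.subset_union_left
    have comp : ∀ y, hitTime P W y ≤ hitTime P (A ∪ W) y +
        (M - (M / (999/10*T)) * (hitTime P A y - hitTime P (A ∪ W) y)) := by
      set k := M / (999/10*T) with hk
      have hk0 : 0 ≤ k := by positivity
      have hkM : k * (999/10*T) = M := by rw [hk]; field_simp
      intro y
      have := max_principle hP hirr (A ∪ W) hAWne
        (fun y => hitTime P W y - hitTime P (A ∪ W) y - M
          + k * (hitTime P A y - hitTime P (A ∪ W) y)) ?_ ?_ y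
      · linarith
      · intro z hz
        simp only [hit_mem P _ z hz]
        rcases Finset.mem_union.mp hz with h1 | h1
        · rw [hit_mem P A z h1]; linarith [hm' z]
        · rw [hit_mem P W z h1]
          have := mul_le_mul_of_nonneg_left (hAT z) hk0
          linarith
      · intro z hz
        have hz' := hz
        rw [Finset.mem_union, not_or] at hz'
        have e : ∀ w, P z w * (hitTime P W w - hitTime P (A ∪ W) w - M
          + k * (hitTime P A w - hitTime P (A ∪ W) w)) =
          P z w * hitTime P W w - P z w * hitTime P (A ∪ W) w - P z w * M
          + k * (P z w * hitTime P A w - P z w * hitTime P (A ∪ W) w) := fun w => by ring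
        simp only [e, Finset.sum_add_distrib, Finset.sum_sub_distrib, ← Finset.mul_sum,
          ← Finset.sum_mul, hP.2 z]
        rw [hit_rec hP hirr A hAne z hz'.1, hit_rec hP hirr W hWne z hz'.2,
          hit_rec hP hirr _ hAWne z hz]
        linarith
    have onC : ∀ y ∈ C, hitTime P W y ≤ T + (3/100) * M := by
      intro y hy
      have h1 : 98 * T ≤ hitTime P A y := by simpa [hC] using hy
      have h2 := comp y
      have h3 := hs y
      have h4 : (97/100) * M ≤ (M / (999/10*T)) * (hitTime P A y - hitTime P (A ∪ W) y) := by
        have : (M / (999/10*T)) * (97*T) ≤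
            (M / (999/10*T)) * (hitTime P A y - hitTime P (A ∪ W) y) :=
          mul_le_mul_of_nonneg_left (by linarith) (by positivity)
        have e : (M / (999/10*T)) * (97*T) = (970/999) * M := by field_simp; ring
        rw [e] at this
        linarith
      linarith
    have hM3 : M ≤ 3 * T := by
      have := hit_transfer hP hirr W C hWne (ne C (by linarith)) (T + (3/100)*M) (by positivity)
        onC m
      have h2 := b50 C hCm m
      linarith
    have := cycle_bound hP hirr hπ Z W hZne hWne ((75/100)*T) (3*T) (by positivity)
      (by positivity) (fun a _ => (hm' a).trans hM3) (fun b hb => by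
        have h1 : (998/10) * T < hitTime P A b := by simpa [hW] using hb
        have := hit_transfer hP hirr A Z hAne hZne ((9905/100)*T) (by positivity)
          (fun y hy => by simp [hZ] at hy; linarith) b
        linarith)
    nlinarith
  -- Step 4
  rw [Finset.sum_union hdis] at hAW
  have h1 : 99/100 ≤ ∑ a ∈ Wᶜ, π a := by rw [compl]; linarith
  have := hit_transfer hP hirr A Wᶜ hAne (ne _ (by linarith)) ((998/10)*T) (by positivity)
      (fun y hy => by simp [hW] at hy; linarith) x
  linarith [b99 _ h1 x]
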